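/- Every subset C of ℝ⁴ with at most 11 elements is T-shaped. -/

import Mathlib

/-- The set `T_n ⊆ ℝⁿ`, with `T_0 = ∅` and `T_{n+1} = (ℝⁿ × {0}) ∪ (T_n × ℝ₊)`. -/
def Tset : (n : ℕ) → Set (Fin n → ℝ)
  | 0 => ∅
  | n + 1 =>
      {x | x (Fin.last n) = 0 ∨
        ((fun i : Fin n => x i.castSucc) ∈ Tset n ∧ 0 ≤ x (Fin.last n))}

/-- `C ⊆ ℝ^{n+1}` is T-shaped if some invertible affine transformation maps it
into `ℝ × T_n`. -/
def IsTShaped (n : ℕ) (C : Set (Fin (n + 1) → ℝ)) : Prop :=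
  ∃ f : (Fin (n + 1) → ℝ) ≃ᵃ[ℝ] (Fin (n + 1) → ℝ),
    ∀ x ∈ C, (fun i : Fin n => f x i.succ) ∈ Tset n

open Module

section TShape
variable {U : Type*} [AddCommGroup U] [Module ℝ U]

/-- homogeneous T-shape -/
def TS (e : Dual ℝ U) (C : Finset U) : Prop :=
  ∃ a b c : Dual ℝ U, c ∉ Submodule.span ℝ {e} ∧ b ∉ Submodule.span ℝ {e, c} ∧
    a ∉ Submodule.span ℝ {e, c, b} ∧
    ∀ x ∈ C, c x = 0 ∨ (0 ≤ c x ∧ (b x = 0 ∨ (0 ≤ b x ∧ a x = 0)))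

def Spans (D : Finset U) : Prop := ∀ g : Dual ℝ U, (∀ x ∈ D, g x = 0) → g = 0

structure IsFacet (D : Finset U) (b : Dual ℝ U) : Prop where
  ne : b ≠ 0
  nonneg : ∀ x ∈ D, 0 ≤ b x
  mult : ∀ g : Dual ℝ U, (∀ x ∈ D, b x = 0 → g x = 0) → ∃ r : ℝ, g = r • b

lemma facet_ext (D : Finset U) (hD : Spans D) (y : U) (n : ℕ) :
    ∀ f : Dual ℝ U, (D.filter (fun x => f x ≠ 0)).card = n → (∀ x ∈ D, 0 ≤ f x) → f y < 0 →
      ∃ b, IsFacet D b ∧ (∀ x ∈ D, f x = 0 → b x = 0) ∧ b y < 0 := by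
  induction n using Nat.strong_induction_on with
  | _ n ih =>
  intro f hn hf hy
  by_cases hfac : IsFacet D f
  · exact ⟨f, hfac, fun _ _ h => h, hy⟩
  have hne : f ≠ 0 := by rintro rfl; simp at hy
  have : ¬ ∀ g : Dual ℝ U, (∀ x ∈ D, f x = 0 → g x = 0) → ∃ r : ℝ, g = r • f :=
    fun h => hfac ⟨hne, hf, h⟩
  push Not at this
  obtain ⟨g, hg, hgf⟩ := this
  have hg' : ∃ h : Dual ℝ U, (∀ x ∈ D, f x = 0 → h x = 0) ∧ h y = 0 ∧ ∃ x ∈ D, h x < 0 := by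
    set h := g - (g y / f y) • f with hh
    have h1 : ∀ x ∈ D, f x = 0 → h x = 0 := by
      intro x hx h0; simp [hh, h0, hg x hx h0]
    have h2 : h y = 0 := by
      have := hy.ne
      simp [hh, this]
    have h3 : h ≠ 0 := fun h0 => hgf _ (sub_eq_zero.mp h0)
    have h4 : ∃ x ∈ D, h x ≠ 0 := by
      by_contra! hc
      exact h3 (hD h hc)
    obtain ⟨x, hx, hx0⟩ := h4
    rcases lt_or_gt_of_ne hx0 with hlt | hgt
    · exact ⟨h, h1, h2, x, hx, hlt⟩
    · exact ⟨-h, fun x hx h0 => by simp [h1 x hx h0], by simp [h2], x, hx, by simpa using hgt⟩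
  obtain ⟨h, h1, h2, x0, hx0, hx0n⟩ := hg'
  obtain ⟨z, hz, hzmin⟩ := Finset.exists_min_image (D.filter (fun x => h x < 0))
    (fun x => f x / (- h x)) ⟨x0, by simp [hx0, hx0n]⟩
  simp only [Finset.mem_filter] at hz hzmin
  set t := f z / (- h z) with ht
  have ht0 : 0 ≤ t := div_nonneg (hf z hz.1) (by linarith [hz.2])
  have hfz : f z ≠ 0 := fun h0 => by have := h1 z hz.1 h0; linarith [hz.2]
  have hnew : (f + t • h) z = 0 := by
    have : h z ≠ 0 := hz.2.ne
    simp [ht]; field_simp; ring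
  have hzero : ∀ x ∈ D, f x = 0 → (f + t • h) x = 0 := by
    intro x hx h0; simp [h0, h1 x hx h0]
  obtain ⟨b, hb, hb1, hb2⟩ := ih _ (by
      rw [← hn]
      apply Finset.card_lt_card
      rw [Finset.ssubset_iff_of_subset]
      · exact ⟨z, by simp [hz.1, hfz], by simp only [Finset.mem_filter, not_and, not_not]; exact fun _ => hnew⟩
      · intro x hx
        simp only [Finset.mem_filter] at hx ⊢
        exact ⟨hx.1, fun h0 => hx.2 (hzero x hx.1 h0)⟩) (f + t • h) rfl (by
      intro x hx
      simp only [LinearMap.add_apply, LinearMap.smul_apply, smul_eq_mul]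
      by_cases hneg : h x < 0
      · have := hzmin x ⟨hx, hneg⟩
        rw [le_div_iff₀ (by linarith)] at this
        linarith
      · have := hf x hx
        have := mul_nonneg ht0 (not_lt.mp hneg)
        linarith) (by simp [h2, hy])
  exact ⟨b, hb, fun x hx h0 => hb1 x hx (hzero x hx h0), hb2⟩

lemma facet_rich (D : Finset U) (hD : Spans D) (e : Dual ℝ U) (he : ∀ x ∈ D, e x = 1)
    (y : U) (hy : y ≠ 0) (hey : e y ≤ 0) : ∃ b, IsFacet D b ∧ b y < 0 := by
  have hg : ∃ g : Dual ℝ U, g y < 0 := by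
    have : ∃ g : Dual ℝ U, g y ≠ 0 := by
      by_contra! hc
      exact hy ((Module.forall_dual_apply_eq_zero_iff ℝ y).mp hc)
    obtain ⟨g, hg⟩ := this
    rcases lt_or_gt_of_ne hg with h | h
    · exact ⟨g, h⟩
    · exact ⟨-g, by simpa using h⟩
  obtain ⟨g, hg⟩ := hg
  set N := ∑ x ∈ D, |g x| with hN
  have hN0 : 0 ≤ N := Finset.sum_nonneg fun _ _ => abs_nonneg _
  obtain ⟨b, hb, -, hb2⟩ := facet_ext D hD y _ (N • e + g) rfl (by
    intro x hx
    have := Finset.single_le_sum (f := fun x => |g x|) (fun _ _ => abs_nonneg _) hx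
    have h2 := neg_abs_le (g x)
    simp only [LinearMap.add_apply, LinearMap.smul_apply, smul_eq_mul, he x hx]
    linarith) (by
    simp only [LinearMap.add_apply, LinearMap.smul_apply, smul_eq_mul]
    have := mul_nonneg hN0 (neg_nonneg.mpr hey)
    linarith)
  exact ⟨b, hb, hb2⟩

variable [FiniteDimensional ℝ U]
set_option linter.unusedSectionVars false

open Classical in
lemma ann_finrank (hU : finrank ℝ U = 5) (E : Finset U) :
    5 ≤ finrank ℝ (Submodule.span ℝ (E : Set U)).dualAnnihilator + E.card := by
  have h1 := Subspace.finrank_add_finrank_dualAnnihilator_eq (Submodule.span ℝ (E : Set U))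
  have h2 := finrank_span_finset_le_card (R := ℝ) E
  rw [Set.finrank] at h2
  omega

lemma mem_ann (E : Finset U) (g : Dual ℝ U) :
    g ∈ (Submodule.span ℝ (E : Set U)).dualAnnihilator ↔ ∀ x ∈ E, g x = 0 := by
  rw [Submodule.mem_dualAnnihilator]
  constructor
  · intro h x hx; exact h x (Submodule.subset_span hx)
  · intro h x hx
    have : Submodule.span ℝ (E : Set U) ≤ LinearMap.ker g := by
      rw [Submodule.span_le]; intro z hz; exact h z hz
    exact this hx

open Classical in
lemma finrank_span3 (a b c : Dual ℝ U) : finrank ℝ (Submodule.span ℝ {a, b, c}) ≤ 3 := by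
  have := finrank_span_finset_le_card (R := ℝ) ({a, b, c} : Finset (Dual ℝ U))
  have h3 := Finset.card_le_three (a := a) (b := b) (c := c)
  simp only [Finset.coe_insert, Finset.coe_singleton] at this
  exact this.trans h3

lemma exists_not_mem (hU : finrank ℝ U = 5) (a b c : Dual ℝ U) :
    ∃ g, g ∉ Submodule.span ℝ {a, b, c} := by
  by_contra! h
  have h1 : Submodule.span ℝ {a, b, c} = ⊤ := by
    rw [eq_top_iff]; intro x _; exact h x
  have h2 := finrank_span3 a b c
  rw [h1, finrank_top, Subspace.dual_finrank_eq, hU] at h2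
  omega

lemma facet_zeros (hU : finrank ℝ U = 5) (D : Finset U) (b : Dual ℝ U) (hb : IsFacet D b) :
    4 ≤ (D.filter (fun x => b x = 0)).card := by
  have h1 := ann_finrank hU (D.filter (fun x => b x = 0))
  have h2 : (Submodule.span ℝ ((D.filter (fun x => b x = 0) : Finset U) : Set U)).dualAnnihilator
      ≤ Submodule.span ℝ {b} := by
    intro g hg
    rw [mem_ann] at hg
    obtain ⟨r, rfl⟩ := hb.mult g (fun x hx h0 => hg x (by simp [hx, h0]))
    exact Submodule.mem_span_singleton.mpr ⟨r, rfl⟩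
  have h3 := Submodule.finrank_mono h2
  have h4 := finrank_span_le_card (R := ℝ) ({b} : Set (Dual ℝ U))
  simp at h4
  omega

/-- the finishing lemma -/
lemma finish (hU : finrank ℝ U = 5) (e : Dual ℝ U) (C : Finset U) (he : ∀ x ∈ C, e x = 1)
    (hT : ¬ TS e C) (c b : Dual ℝ U) (hce : c ∉ Submodule.span ℝ {e})
    (hbc : b ∉ Submodule.span ℝ {e, c}) (hc : ∀ x ∈ C, 0 ≤ c x)
    (hb : ∀ x ∈ C, c x ≠ 0 → 0 ≤ b x) (E : Finset U)
    (hE : ∀ x, x ∈ E ↔ x ∈ C ∧ c x ≠ 0 ∧ b x ≠ 0) (hcard : E.card ≤ 3) :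
    E.card = 3 ∧ ∀ u ∈ E, ∀ v ∈ E, c u = c v ∧ b u = b v := by
  have hle : (Submodule.span ℝ (E : Set U)).dualAnnihilator ≤ Submodule.span ℝ {e, c, b} := by
    intro a ha
    by_contra hna
    apply hT
    refine ⟨a, b, c, hce, hbc, hna, fun x hx => ?_⟩
    rw [mem_ann] at ha
    by_cases h0 : c x = 0
    · exact Or.inl h0
    refine Or.inr ⟨hc x hx, ?_⟩
    by_cases h1 : b x = 0
    · exact Or.inl h1
    exact Or.inr ⟨hb x hx h0, ha x ((hE x).2 ⟨hx, h0, h1⟩)⟩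
  have h5 := ann_finrank hU E
  have h3 := finrank_span3 e c b
  have hne : E.Nonempty := by
    by_contra hne
    rw [Finset.not_nonempty_iff_eq_empty] at hne
    have := Submodule.finrank_mono hle
    rw [hne] at this h5
    simp only [Finset.card_empty] at h5
    omega
  have key : ∀ v ∈ E, 3 ≤ E.card ∧ ∀ u ∈ E, c u = c v ∧ b u = b v := by
    intro v hv
    set P := Submodule.span ℝ {e, c, b} with hP
    have hev : e v = 1 := he v ((hE v).1 hv).1
    set Q := P ⊓ LinearMap.ker (Dual.eval ℝ U v) with hQ
    have heP : e ∈ P := Submodule.subset_span (by simp)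
    have hcP : c ∈ P := Submodule.subset_span (by simp)
    have hbP : b ∈ P := Submodule.subset_span (by simp)
    have hlt : Q < P := by
      refine lt_of_le_of_ne inf_le_left fun h => ?_
      have : e ∈ Q := h ▸ heP
      have := this.2
      simp [hev] at this
    have hQ2 := Submodule.finrank_lt_finrank_of_lt hlt
    have hleQ : (Submodule.span ℝ (E : Set U)).dualAnnihilator ≤ Q := by
      intro g hg
      refine ⟨hle hg, ?_⟩
      rw [mem_ann] at hg
      simpa using hg v hv
    have := Submodule.finrank_mono hleQ
    refine ⟨by omega, ?_⟩
    have heq := Submodule.eq_of_le_of_finrank_le hleQ (by omega)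
    have gen : ∀ f ∈ P, ∀ u ∈ E, f u = f v := by
      intro f hf u hu
      have : f - (f v) • e ∈ Q := by
        refine ⟨P.sub_mem hf (P.smul_mem _ heP), ?_⟩
        simp [hev]
      rw [← heq, mem_ann] at this
      have h := this u hu
      simp [he u ((hE u).1 hu).1] at h
      linarith
    intro u hu
    exact ⟨gen c hcP u hu, gen b hbP u hu⟩
  obtain ⟨v, hv⟩ := hne
  exact ⟨le_antisymm hcard (key v hv).1, fun u hu w hw => (key w hw).2 u hu⟩

/-- if a nontrivial functional vanishes outside the zero set, we are done -/
lemma no_b (hU : finrank ℝ U = 5) (e : Dual ℝ U) (C : Finset U) (he : ∀ x ∈ C, e x = 1)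
    (hT : ¬ TS e C) (c b : Dual ℝ U) (hce : c ∉ Submodule.span ℝ {e})
    (hbc : b ∉ Submodule.span ℝ {e, c}) (hc : ∀ x ∈ C, 0 ≤ c x)
    (hb : ∀ x ∈ C, c x ≠ 0 → b x = 0) : False := by
  have := finish hU e C he hT c b hce hbc hc (fun x hx h => (hb x hx h).ge) ∅
    (fun x => by simp; intro h1 h2; exact hb x h1 h2) (by simp)
  simp at this

lemma no_c (hU : finrank ℝ U = 5) (e : Dual ℝ U) (C : Finset U) (he : ∀ x ∈ C, e x = 1)
    (hT : ¬ TS e C) (c : Dual ℝ U) (hce : c ∉ Submodule.span ℝ {e})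
    (hc : ∀ x ∈ C, c x = 0) : False := by
  obtain ⟨b, hb⟩ := exists_not_mem hU e c c
  exact no_b hU e C he hT c b hce (by simpa using hb) (fun x hx => (hc x hx).ge)
    (fun x hx h => absurd (hc x hx) h)

end TShape

open Module
section TShape
variable {U : Type*} [AddCommGroup U] [Module ℝ U] [FiniteDimensional ℝ U]

structure Bad (e : Dual ℝ U) (C : Finset U) : Prop where
  hU : finrank ℝ U = 5
  he : ∀ x ∈ C, e x = 1
  hT : ¬ TS e C
  h11 : C.card ≤ 11

variable {e : Dual ℝ U} {C : Finset U}

set_option linter.unusedSectionVars false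

lemma not_mem_pair {b c : Dual ℝ U} {y : U} (hb : b y < 0) (he : e y = 0) (hc : c y = 0) :
    b ∉ Submodule.span ℝ {e, c} := by
  intro h
  obtain ⟨r, t, rfl⟩ := Submodule.mem_span_pair.mp h
  simp [he, hc] at hb

lemma exists_ker (hU : finrank ℝ U = 5) (e c : Dual ℝ U) : ∃ y : U, y ≠ 0 ∧ e y = 0 ∧ c y = 0 := by
  have h := LinearMap.ker_ne_bot_of_finrank_lt (f := e.prod c) (by simp [hU])
  obtain ⟨y, hy, hy0⟩ := Submodule.exists_mem_ne_zero_of_ne_bot h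
  simp at hy
  exact ⟨y, hy0, hy.1, hy.2⟩

lemma Bad.spans (h : Bad e C) : Spans C := by
  intro g hg
  by_contra hg0
  by_cases hge : g ∈ Submodule.span ℝ {e}
  · obtain ⟨r, rfl⟩ := Submodule.mem_span_singleton.mp hge
    have hC : C = ∅ := by
      by_contra hC
      obtain ⟨x, hx⟩ := Finset.nonempty_iff_ne_empty.mpr hC
      have := hg x hx
      simp [h.he x hx] at this
      simp [this] at hg0
    obtain ⟨c, hc⟩ := exists_not_mem h.hU e e e
    exact no_c h.hU e C h.he h.hT c (by simpa using hc) (by simp [hC])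
  · exact no_c h.hU e C h.he h.hT g hge hg

lemma Bad.nonempty (h : Bad e C) : C.Nonempty := by
  by_contra hC
  rw [Finset.not_nonempty_iff_eq_empty] at hC
  obtain ⟨c, hc⟩ := exists_not_mem h.hU e e e
  exact no_c h.hU e C h.he h.hT c (by simpa using hc) (by simp [hC])

open Classical in
lemma Bad.two_levels_aux (h : Bad e C) (c : Dual ℝ U) (hce : c ∉ Submodule.span ℝ {e})
    (hc : ∀ x ∈ C, 0 ≤ c x) 
    (hcard : (C.filter (fun x => c x ≠ 0)).card ≤ 5) (z : U) (hz : z ∈ C) (hz0 : c z = 0) :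
    False := by
  set D := C.filter (fun x => c x ≠ 0) with hD
  by_cases hs : Spans (insert z D)
  · obtain ⟨y, hy, hey, hcy⟩ := exists_ker h.hU e c
    obtain ⟨b, hb, hby⟩ := facet_rich _ hs e (by
      intro x hx
      rw [Finset.mem_insert] at hx
      rcases hx with rfl | hx
      · exact h.he _ hz
      · exact h.he x (Finset.mem_filter.mp hx).1) y hy hey.le
    have h4 := facet_zeros h.hU _ b hb
    have h5 : ((insert z D).filter (fun x => b x = 0)).card ≤
        (D.filter (fun x => b x = 0)).card + 1 := by
      refine (Finset.card_le_card (t := insert z (D.filter (fun x => b x = 0))) ?_).trans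
        (Finset.card_insert_le _ _)
      intro x hx
      simp only [Finset.mem_filter, Finset.mem_insert] at hx ⊢
      tauto
    have h6 := Finset.card_filter_add_card_filter_not (s := D) (fun x => b x = 0)
    have := finish h.hU e C h.he h.hT c b hce (not_mem_pair hby hey hcy) hc
      (fun x hx h0 => hb.nonneg x (by simp [hD, hx, h0])) (D.filter (fun x => ¬ b x = 0))
      (by intro x; simp [hD, and_assoc]) (by omega)
    omega
  · simp only [Spans] at hs
    push Not at hs
    obtain ⟨g, hg, hg0⟩ := hs
    refine no_b h.hU e C h.he h.hT c g hce ?_ hc (fun x hx h0 => hg x (by simp [hD, hx, h0]))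
    intro hmem
    obtain ⟨r, t, rfl⟩ := Submodule.mem_span_pair.mp hmem
    have h1 := hg z (by simp)
    simp [h.he z hz, hz0] at h1
    have : ∃ v ∈ C, c v ≠ 0 := by
      by_contra! hv
      exact no_c h.hU e C h.he h.hT c hce hv
    obtain ⟨v, hv, hv0⟩ := this
    have h2 := hg v (by simp [hD, hv, hv0])
    simp [h1, hv0] at h2
    simp [h1, h2] at hg0

lemma Bad.two_levels (h : Bad e C) (c : Dual ℝ U) (hce : c ∉ Submodule.span ℝ {e})
    (hc : ∀ x ∈ C, 0 ≤ c x) (γ : ℝ) (hγ : ∀ x ∈ C, c x ≠ 0 → c x = γ)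
    (z : U) (hz : z ∈ C) (hz0 : c z = 0) : False := by
  have hv : ∃ v ∈ C, c v ≠ 0 := by
    by_contra! hv
    exact no_c h.hU e C h.he h.hT c hce hv
  obtain ⟨v, hv, hv0⟩ := hv
  have hγ0 : 0 < γ := by
    have := hγ v hv hv0
    rw [← this]
    exact lt_of_le_of_ne (hc v hv) (Ne.symm hv0)
  have h6 := Finset.card_filter_add_card_filter_not (s := C) (fun x => c x = 0)
  have h7 := h.h11
  by_cases h5 : (C.filter (fun x => c x ≠ 0)).card ≤ 5
  · exact h.two_levels_aux c hce hc h5 z hz hz0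
  · have hval : ∀ x ∈ C, (γ • e - c) x = γ - c x := by
      intro x hx; simp [h.he x hx]
    refine h.two_levels_aux (γ • e - c) ?_ ?_ ?_ v hv ?_
    · intro hmem
      apply hce
      have := Submodule.sub_mem _
        (Submodule.smul_mem _ γ (Submodule.mem_span_singleton_self e)) hmem
      simpa using this
    · intro x hx
      rw [hval x hx]
      by_cases h0 : c x = 0
      · rw [h0]; linarith
      · rw [hγ x hx h0]; linarith
    · have : C.filter (fun x => (γ • e - c) x ≠ 0) ⊆ C.filter (fun x => c x = 0) := by
        intro x hx
        rw [Finset.mem_filter] at hx ⊢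
        refine ⟨hx.1, ?_⟩
        by_contra h0
        apply hx.2
        rw [hval x hx.1, hγ x hx.1 h0]; simp
      have := Finset.card_le_card this
      simp only [ne_eq] at *
      omega
    · rw [hval v hv, hγ v hv hv0]; simp

lemma Bad.facet_zero (h : Bad e C) {c : Dual ℝ U} (hc : IsFacet C c) : ∃ z ∈ C, c z = 0 := by
  have h4 := facet_zeros h.hU C c hc
  obtain ⟨z, hz⟩ := Finset.card_pos.mp (by omega : 0 < (C.filter (fun x => c x = 0)).card)
  rw [Finset.mem_filter] at hz
  exact ⟨z, hz⟩

lemma Bad.facet_ne (h : Bad e C) {c : Dual ℝ U} (hc : IsFacet C c) :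
    c ∉ Submodule.span ℝ {e} := by
  obtain ⟨z, hz, hz0⟩ := h.facet_zero hc
  intro hmem
  obtain ⟨r, rfl⟩ := Submodule.mem_span_singleton.mp hmem
  simp [h.he z hz] at hz0
  exact hc.ne (by simp [hz0])

/-- The points off a facet span. -/
lemma Bad.facet_spans (h : Bad e C) {c : Dual ℝ U} (hc : IsFacet C c) :
    Spans (C.filter (fun x => c x ≠ 0)) := by
  intro g hg
  by_contra hg0
  have hce := h.facet_ne hc
  have hg' : ∀ x ∈ C, c x ≠ 0 → g x = 0 := fun x hx h0 => hg x (by simp [hx, h0])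
  by_cases hmem : g ∈ Submodule.span ℝ {e, c}
  · obtain ⟨r, t, rfl⟩ := Submodule.mem_span_pair.mp hmem
    have hv : ∃ v ∈ C, c v ≠ 0 := by
      by_contra! hv
      exact no_c h.hU e C h.he h.hT c hce hv
    obtain ⟨v, hv, hv0⟩ := hv
    have ht : t ≠ 0 := by
      rintro rfl
      have := hg' v hv hv0
      simp [h.he v hv] at this
      simp [this] at hg0
    obtain ⟨z, hz, hz0⟩ := h.facet_zero hc
    refine h.two_levels c hce hc.nonneg (-r / t) ?_ z hz hz0
    intro x hx h0
    have := hg' x hx h0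
    simp [h.he x hx] at this
    field_simp
    linarith
  · exact no_b h.hU e C h.he h.hT c g hce hmem hc.nonneg hg'

/-- Nonparallel facets of the remainder. -/
lemma Bad.bad_facet (h : Bad e C) {c : Dual ℝ U} (hc : IsFacet C c) {b : Dual ℝ U}
    (hb : IsFacet (C.filter (fun x => c x ≠ 0)) b) (hbc : b ∉ Submodule.span ℝ {e, c}) :
    ((C.filter (fun x => c x ≠ 0)).filter (fun x => b x ≠ 0)).card = 3 ∧
    (C.filter (fun x => c x = 0)).card = 4 ∧ (C.filter (fun x => c x ≠ 0)).card = 7 ∧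
    ∀ u ∈ C, ∀ v ∈ C, c u ≠ 0 → c v ≠ 0 → b u ≠ 0 → b v ≠ 0 → c u = c v ∧ b u = b v := by
  have h1 := facet_zeros h.hU C c hc
  have h2 := facet_zeros h.hU _ b hb
  have h3 := Finset.card_filter_add_card_filter_not (s := C) (fun x => c x = 0)
  have h4 := Finset.card_filter_add_card_filter_not
    (s := C.filter (fun x => ¬ c x = 0)) (fun x => b x = 0)
  have h5 := h.h11
  have := finish h.hU e C h.he h.hT c b (h.facet_ne hc) hbc hc.nonneg
    (fun x hx h0 => hb.nonneg x (by simp [hx, h0]))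
    ((C.filter (fun x => ¬ c x = 0)).filter (fun x => ¬ b x = 0))
    (by intro x; simp [and_assoc]) (by simp only [ne_eq] at *; omega)
  obtain ⟨h6, h7⟩ := this
  simp only [ne_eq] at *
  refine ⟨h6, by omega, by omega, ?_⟩
  intro u hu v hv a1 a2 a3 a4
  exact h7 u (by simp [hu, a1, a3]) v (by simp [hv, a2, a4])

lemma Bad.exists_bad (h : Bad e C) {c : Dual ℝ U} (hc : IsFacet C c) (y : U) (hy : y ≠ 0)
    (hey : e y = 0) (hcy : c y = 0) : ∃ b, IsFacet (C.filter (fun x => c x ≠ 0)) b ∧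
      b ∉ Submodule.span ℝ {e, c} ∧ b y < 0 := by
  obtain ⟨b, hb, hby⟩ := facet_rich _ (h.facet_spans hc) e
    (fun x hx => h.he x (Finset.mem_filter.mp hx).1) y hy hey.le
  exact ⟨b, hb, not_mem_pair hby hey hcy, hby⟩

lemma Bad.cards (h : Bad e C) {c : Dual ℝ U} (hc : IsFacet C c) :
    (C.filter (fun x => c x = 0)).card = 4 ∧ (C.filter (fun x => c x ≠ 0)).card = 7 := by
  obtain ⟨y, hy, hey, hcy⟩ := exists_ker h.hU e c
  obtain ⟨b, hb, hbc, -⟩ := h.exists_bad hc y hy hey hcy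
  have := h.bad_facet hc hb hbc
  exact ⟨this.2.1, this.2.2.1⟩

open Classical in
/-- all but one point of the remainder lie on a level of `c` -/
lemma Bad.six_one (h : Bad e C) {c : Dual ℝ U} (hc : IsFacet C c) :
    ∃ p ∈ C, c p ≠ 0 ∧ ∃ γ : ℝ, 0 < γ ∧ c p ≠ γ ∧ ∀ x ∈ C, c x ≠ 0 → x ≠ p → c x = γ := by
  set D := C.filter (fun x => c x ≠ 0) with hD
  have hDm : ∀ x, x ∈ D ↔ x ∈ C ∧ c x ≠ 0 := by intro x; simp [hD]
  have hD7 : D.card = 7 := (h.cards hc).2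
  -- nonsingleton levels have at least four points
  have hlev : ∀ u ∈ D, ∀ v ∈ D, u ≠ v → c u = c v →
      4 ≤ (D.filter (fun x => c x = c v)).card := by
    intro u hu v hv huv hcuv
    have hu' := (hDm u).1 hu
    have hv' := (hDm v).1 hv
    obtain ⟨b, hb, hbc, hby⟩ := h.exists_bad hc (u - v) (sub_ne_zero.mpr huv)
      (by simp [h.he u hu'.1, h.he v hv'.1]) (by simp [hcuv])
    obtain ⟨h3, -, -, hconst⟩ := h.bad_facet hc hb hbc
    have hbu := hb.nonneg u hu
    have hlt : b u < b v := by simpa using hby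
    have hbv : b v ≠ 0 := by linarith
    have hbu0 : b u = 0 := by
      by_contra h0
      have := (hconst u hu'.1 v hv'.1 hu'.2 hv'.2 h0 hbv).2
      linarith
    have hsub : insert u (D.filter (fun x => b x ≠ 0)) ⊆ D.filter (fun x => c x = c v) := by
      intro x hx
      rw [Finset.mem_insert] at hx
      rcases hx with rfl | hx
      · simp [hu, hcuv]
      · rw [Finset.mem_filter] at hx ⊢
        have hx' := (hDm x).1 hx.1
        exact ⟨hx.1, (hconst x hx'.1 v hv'.1 hx'.2 hv'.2 hx.2 hbv).1⟩
    have := Finset.card_le_card hsub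
    rw [Finset.card_insert_of_notMem (by simp [hbu0]), h3] at this
    exact this
  -- the big level
  obtain ⟨y, hy, hey, hcy⟩ := exists_ker h.hU e c
  obtain ⟨b0, hb0, hbc0, -⟩ := h.exists_bad hc y hy hey hcy
  obtain ⟨h30, -, -, hconst0⟩ := h.bad_facet hc hb0 hbc0
  obtain ⟨u0, hu0, v0, hv0, huv0⟩ := Finset.one_lt_card.mp (by omega :
    1 < ((C.filter (fun x => c x ≠ 0)).filter (fun x => b0 x ≠ 0)).card)
  rw [← hD, Finset.mem_filter] at hu0 hv0
  have hu0' := (hDm u0).1 hu0.1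
  have hv0' := (hDm v0).1 hv0.1
  have hcuv0 := (hconst0 u0 hu0'.1 v0 hv0'.1 hu0'.2 hv0'.2 hu0.2 hv0.2).1
  have hL := hlev u0 hu0.1 v0 hv0.1 huv0 hcuv0
  set γ := c v0 with hγ
  have hγpos : 0 < γ := lt_of_le_of_ne (hc.nonneg v0 hv0'.1) (Ne.symm hv0'.2)
  -- points off the big level are alone on their level
  have hsing : ∀ x ∈ D, c x ≠ γ → ∀ x' ∈ D, x' ≠ x → c x' ≠ c x := by
    intro x hx hxγ x' hx' hne heq
    have h4 := hlev x' hx' x hx hne heq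
    have hdisj : Disjoint (D.filter (fun z => c z = γ)) (D.filter (fun z => c z = c x)) := by
      rw [Finset.disjoint_filter]
      intro z _ h1 h2
      exact hxγ (by rw [← h2, h1])
    have h5 := Finset.card_union_of_disjoint hdisj
    have h6 := Finset.card_le_card (Finset.union_subset
      (Finset.filter_subset (fun z => c z = γ) D) (Finset.filter_subset (fun z => c z = c x) D))
    omega
  have hvan : ∀ x ∈ D, c x ≠ γ → ∀ b, IsFacet D b → b ∉ Submodule.span ℝ {e, c} → b x = 0 := by
    intro x hx hxγ b hb hbc
    by_contra hbx
    obtain ⟨h3, -, -, hconst⟩ := h.bad_facet hc hb hbc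
    obtain ⟨w, hw, hwx⟩ := Finset.exists_mem_ne (by omega :
      1 < ((C.filter (fun x => c x ≠ 0)).filter (fun x => b x ≠ 0)).card) x
    rw [← hD, Finset.mem_filter] at hw
    have hx' := (hDm x).1 hx
    have hw' := (hDm w).1 hw.1
    exact hsing x hx hxγ w hw.1 hwx (hconst w hw'.1 x hx'.1 hw'.2 hx'.2 hw.2 hbx).1
  -- there is a point off the level
  have hex : ∃ p ∈ D, c p ≠ γ := by
    by_contra! hall
    have := h.facet_spans hc (c - γ • e) (by
      intro x hx
      have hx' := (hDm x).1 hx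
      simp [h.he x hx'.1, hall x hx])
    apply h.facet_ne hc
    rw [sub_eq_zero] at this
    exact Submodule.mem_span_singleton.mpr ⟨γ, this.symm⟩
  obtain ⟨p, hp, hpγ⟩ := hex
  have hp' := (hDm p).1 hp
  refine ⟨p, hp'.1, hp'.2, γ, hγpos, hpγ, ?_⟩
  intro x hxC hx0 hxp
  by_contra hxγ
  have hx : x ∈ D := (hDm x).2 ⟨hxC, hx0⟩
  have hcx := hsing p hp hpγ x hx hxp
  have hd : c x - c p ≠ 0 := sub_ne_zero.mpr hcx
  have hm : ∀ m ∈ D, c m = γ →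
      m = ((γ - c p) / (c x - c p)) • x + (1 - (γ - c p) / (c x - c p)) • p := by
    intro m hm hmγ
    have hm' := (hDm m).1 hm
    by_contra hne
    obtain ⟨b, hb, hbc, hby⟩ := h.exists_bad hc _ (sub_ne_zero.mpr hne)
      (by simp [h.he m hm'.1, h.he x hxC, h.he p hp'.1]) (by
        simp [hmγ]; field_simp; ring)
    have h1 := hvan x hx hxγ b hb hbc
    have h2 := hvan p hp hpγ b hb hbc
    have h3 := hb.nonneg m hm
    simp [h1, h2] at hby
    linarith
  exact huv0 ((hm u0 hu0.1 hcuv0).trans (hm v0 hv0.1 rfl).symm)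

end TShape

open Module
section TShape
variable {U : Type*} [AddCommGroup U] [Module ℝ U] [FiniteDimensional ℝ U]
variable {e : Dual ℝ U} {C : Finset U}

set_option linter.unusedSectionVars false

lemma IsFacet.smul {D : Finset U} {b : Dual ℝ U} (hb : IsFacet D b) {r : ℝ} (hr : 0 < r) :
    IsFacet D (r • b) where
  ne := smul_ne_zero hr.ne' hb.ne
  nonneg x hx := by simpa using mul_nonneg hr.le (hb.nonneg x hx)
  mult g hg := by
    obtain ⟨t, rfl⟩ := hb.mult g (fun x hx h0 => hg x hx (by simp [h0]))
    exact ⟨t / r, by rw [smul_smul, div_mul_cancel₀ _ hr.ne']⟩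

open Classical in
/-- A facet through all zeros of `c` except `s`. -/
lemma Bad.tilt (h : Bad e C) {c : Dual ℝ U} (hc : IsFacet C c) {s : U} (hs : s ∈ C)
    (hs0 : c s = 0) : ∃ k, IsFacet C k ∧ (∀ x ∈ C, c x = 0 → x ≠ s → k x = 0) ∧ 0 < k s := by
  set S := C.filter (fun x => c x = 0) with hS
  have hScard : S.card = 4 := (h.cards hc).1
  have hsS : s ∈ S := by simp [hS, hs, hs0]
  have h3 : (S.erase s).card = 3 := by rw [Finset.card_erase_of_mem hsS, hScard]
  have hg : ∃ g : Dual ℝ U, (∀ x ∈ S.erase s, g x = 0) ∧ g ∉ Submodule.span ℝ {c} := by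
    by_contra! hcon
    have h1 := ann_finrank h.hU (S.erase s)
    have h2 : (Submodule.span ℝ ((S.erase s : Finset U) : Set U)).dualAnnihilator
      ≤ Submodule.span ℝ {c} := by
      intro g hg
      exact hcon g ((mem_ann _ _).1 hg)
    have h3 := Submodule.finrank_mono h2
    have h4 := finrank_span_le_card (R := ℝ) ({c} : Set (Dual ℝ U))
    simp at h4
    omega
  obtain ⟨g, hg, hgc⟩ := hg
  have hgs : g s ≠ 0 := by
    intro h0
    obtain ⟨r, hr⟩ := hc.mult g (by
      intro x hx hx0
      by_cases hxs : x = s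
      · rw [hxs, h0]
      · exact hg x (by simp [hS, hx, hx0, hxs]))
    exact hgc (Submodule.mem_span_singleton.mpr ⟨r, hr.symm⟩)
  set g' := (g s)⁻¹ • g with hg'
  have hg's : g' s = 1 := by simp [hg', hgs]
  have hg'0 : ∀ x ∈ C, c x = 0 → x ≠ s → g' x = 0 := by
    intro x hx hx0 hxs
    simp [hg', hg x (by simp [hS, hx, hx0, hxs])]
  set N := ∑ x ∈ C, |g' x| / c x with hN
  obtain ⟨b, hb, hb1, hb2⟩ := facet_ext C h.spans (-s) _ (N • c + g') rfl (by
    intro x hx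
    simp only [LinearMap.add_apply, LinearMap.smul_apply, smul_eq_mul]
    by_cases hx0 : c x = 0
    · by_cases hxs : x = s
      · rw [hxs, hg's, hs0]; norm_num
      · rw [hg'0 x hx hx0 hxs, hx0]; simp
    · have hpos : 0 < c x := lt_of_le_of_ne (hc.nonneg x hx) (Ne.symm hx0)
      have := Finset.single_le_sum (f := fun x => |g' x| / c x)
        (fun z hz => div_nonneg (abs_nonneg _) (hc.nonneg z hz)) hx
      rw [← hN, div_le_iff₀ hpos] at this
      have h2 := neg_abs_le (g' x)
      linarith) (by simp [hs0, hg's])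
  refine ⟨b, hb, ?_, by simpa using hb2⟩
  intro x hx hx0 hxs
  exact hb1 x hx (by simp [hx0, hg'0 x hx hx0 hxs])

open Classical in
lemma Bad.key (h : Bad e C) {c : Dual ℝ U} (hc : IsFacet C c) {p : U} (hp : p ∈ C) {γ : ℝ}
    (hγ : 0 < γ) (hpγ : γ < c p) (hO : ∀ x ∈ C, c x ≠ 0 → x ≠ p → c x = γ) {s : U}
    (hs : s ∈ C) (hs0 : c s = 0) :
    ∃ (k : Dual ℝ U) (x q : U), IsFacet C k ∧ (∀ z ∈ C, c z = 0 → z ≠ s → k z = 0) ∧ k s = 1 ∧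
      k p = 1 ∧ (x ∈ C ∧ c x = γ ∧ k x = 0) ∧ (q ∈ C ∧ c q = γ ∧ 0 < k q) ∧
      ∀ o ∈ C, c o = γ → o ≠ x → o ≠ q → k o = 1 := by
  obtain ⟨k, hk, hk0, hks⟩ := h.tilt hc hs hs0
  set S := C.filter (fun x => c x = 0) with hS
  have hScard : S.card = 4 := (h.cards hc).1
  have hsS : s ∈ S := by simp [hS, hs, hs0]
  have h3 : (S.erase s).card = 3 := by rw [Finset.card_erase_of_mem hsS, hScard]
  have hsp : s ≠ p := by rintro rfl; linarith
  obtain ⟨s', hs'⟩ := Finset.card_pos.mp (by omega : 0 < (S.erase s).card)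
  rw [Finset.mem_erase, hS, Finset.mem_filter] at hs'
  obtain ⟨hs's, hs'C, hs'0⟩ := hs'
  have hks' := hk0 s' hs'C hs'0 hs's
  -- independence
  have hind : ∀ r t w : ℝ, w • k + r • e + t • c = 0 → w = 0 := by
    intro r t w heq
    have h1 := LinearMap.congr_fun heq s
    have h2 := LinearMap.congr_fun heq s'
    simp [h.he s hs, hs0] at h1
    simp [h.he s' hs'C, hs'0, hks'] at h2
    simp [h2] at h1
    rcases h1 with h1 | h1
    · exact h1
    · linarith
  have hkp : k p ≠ 0 := by
    intro hkp
    have := finish h.hU e C h.he h.hT k (γ • e - c) (h.facet_ne hk) (by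
      intro hmem
      obtain ⟨r, t, hrt⟩ := Submodule.mem_span_pair.mp hmem
      have ht : t = 0 := hind (r - γ) 1 t (by
        rw [← sub_eq_zero.mpr hrt]
        module)
      apply h.facet_ne hc
      rw [ht] at hrt
      refine Submodule.mem_span_singleton.mpr ⟨γ - r, ?_⟩
      rw [sub_smul]
      simp at hrt
      rw [hrt]; simp) hk.nonneg (by
      intro x hx hkx
      have hxp : x ≠ p := by rintro rfl; exact hkx hkp
      simp [h.he x hx]
      by_cases hx0 : c x = 0
      · linarith
      · exact (hO x hx hx0 hxp).le) {s} (by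
      intro x
      rw [Finset.mem_singleton]
      constructor
      · rintro rfl
        refine ⟨hs, hks.ne', ?_⟩
        simp [h.he x hs, hs0, hγ.ne']
      · rintro ⟨hx, hkx, hx1⟩
        by_contra hxs
        have hxp : x ≠ p := by rintro rfl; exact hkx hkp
        by_cases hx0 : c x = 0
        · exact hkx (hk0 x hx hx0 hxs)
        · apply hx1
          simp [h.he x hx, hO x hx hx0 hxp]) (by simp)
    simp at this
  -- the fourth zero
  have hZcard := (h.cards hk).1
  obtain ⟨x, hxZ, hxS⟩ := Finset.exists_mem_notMem_of_card_lt_card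
    (by omega : (S.erase s).card < (C.filter (fun x => k x = 0)).card)
  have hZeq : insert x (S.erase s) = C.filter (fun x => k x = 0) := by
    apply Finset.eq_of_subset_of_card_le
    · intro z hz
      rw [Finset.mem_insert] at hz
      rcases hz with rfl | hz
      · exact hxZ
      · rw [Finset.mem_erase, hS, Finset.mem_filter] at hz
        rw [Finset.mem_filter]
        exact ⟨hz.2.1, hk0 z hz.2.1 hz.2.2 hz.1⟩
    · rw [Finset.card_insert_of_notMem hxS]; omega
  rw [Finset.mem_filter] at hxZ
  obtain ⟨hxC, hkx⟩ := hxZ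
  have hxs : x ≠ s := by rintro rfl; linarith
  have hx0 : c x ≠ 0 := by
    intro h0
    exact hxS (by simp [hS, hxs, hxC, h0])
  have hxp : x ≠ p := by rintro rfl; exact hkp hkx
  have hxγ := hO x hxC hx0 hxp
  have hOx : ∀ o ∈ C, c o = γ → o ≠ x → k o ≠ 0 := by
    intro o ho hoγ hox hko
    have : o ∈ insert x (S.erase s) := by rw [hZeq]; simp [ho, hko]
    simp [hox, hS, hoγ, hγ.ne'] at this
  obtain ⟨q, hq, hkq, δ, hδ, hqδ, hlev⟩ := h.six_one hk
  have hqγ : c q = γ := by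
    by_contra hne
    have hlev' : ∀ o ∈ C, c o = γ → o ≠ x → k o = δ := by
      intro o ho hoγ hox
      exact hlev o ho (hOx o ho hoγ hox) (by rintro rfl; exact hne hoγ)
    have hd : c p - γ ≠ 0 := by linarith
    set b : Dual ℝ U := (δ • e - k) + ((k p - δ) / (c p - γ)) • (c - γ • e) with hb
    have hbval : ∀ z ∈ C, b z = δ - k z + ((k p - δ) / (c p - γ)) * (c z - γ) := by
      intro z hz; simp [hb, h.he z hz]
    have hbp : b p = 0 := by
      rw [hbval p hp]; field_simp; ring
    have hbO : ∀ o ∈ C, c o = γ → o ≠ x → b o = 0 := by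
      intro o ho hoγ hox
      rw [hbval o ho, hlev' o ho hoγ hox, hoγ]; simp
    have hbx : b x = δ := by
      rw [hbval x hxC, hkx, hxγ]; simp
    have := finish h.hU e C h.he h.hT c b (h.facet_ne hc) (by
      intro hmem
      obtain ⟨r, t, hrt⟩ := Submodule.mem_span_pair.mp hmem
      have := hind (r - δ + ((k p - δ) / (c p - γ)) * γ) (t - (k p - δ) / (c p - γ)) 1 (by
        rw [hb] at hrt
        rw [← sub_eq_zero.mpr hrt]
        module)
      norm_num at this) hc.nonneg (by
      intro z hz hz0
      by_cases hzx : z = x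
      · rw [hzx, hbx]; exact hδ.le
      by_cases hzp : z = p
      · rw [hzp, hbp]
      · rw [hbO z hz (hO z hz hz0 hzp) hzx]) {x} (by
      intro z
      rw [Finset.mem_singleton]
      constructor
      · rintro rfl
        exact ⟨hxC, hx0, by rw [hbx]; exact hδ.ne'⟩
      · rintro ⟨hz, hz0, hz1⟩
        by_contra hzx
        by_cases hzp : z = p
        · exact hz1 (by rw [hzp, hbp])
        · exact hz1 (hbO z hz (hO z hz hz0 hzp) hzx)) (by simp)
    simp at this
  have hksδ : k s = δ := hlev s hs hks.ne' (by rintro rfl; linarith)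
  have hkpδ : k p = δ := hlev p hp hkp (by rintro rfl; linarith)
  refine ⟨δ⁻¹ • k, x, q, hk.smul (inv_pos.mpr hδ), ?_, ?_, ?_, ⟨hxC, hxγ, by simp [hkx]⟩,
    ⟨hq, hqγ, ?_⟩, ?_⟩
  · intro z hz hz0 hzs; simp [hk0 z hz hz0 hzs]
  · simp [hksδ, hδ.ne']
  · simp [hkpδ, hδ.ne']
  · have : 0 < k q := lt_of_le_of_ne (hk.nonneg q hq) (Ne.symm hkq)
    simp only [LinearMap.smul_apply, smul_eq_mul]
    positivity
  · intro o ho hoγ hox hoq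
    simp [hlev o ho (hOx o ho hoγ hox) hoq, hδ.ne']

open Classical in
lemma Bad.false (h : Bad e C) : False := by
  obtain ⟨v, hv⟩ := h.nonempty
  have hv0 : -v ≠ 0 := by
    intro h0
    have := h.he v hv
    rw [neg_eq_zero.mp h0] at this
    simp at this
  obtain ⟨c, hc, -⟩ := facet_rich C h.spans e h.he (-v) hv0 (by simp [h.he v hv])
  obtain ⟨p, hp, hp0, γ, hγ, hpγ, hO⟩ := h.six_one hc
  obtain ⟨h4, h7⟩ := h.cards hc
  set S := C.filter (fun x => c x = 0) with hS
  set O := (C.filter (fun x => c x ≠ 0)).erase p with hOdef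
  have hO6 : O.card = 6 := by
    rw [hOdef, Finset.card_erase_of_mem (by simp [hp, hp0]), h7]
  have hOm : ∀ x, x ∈ O → x ∈ C ∧ c x = γ := by
    intro x hx
    rw [hOdef, Finset.mem_erase, Finset.mem_filter] at hx
    exact ⟨hx.2.1, hO x hx.2.1 hx.2.2 hx.1⟩
  rcases lt_or_gt_of_ne hpγ with hlt | hgt
  · -- the level of `O` is a facet with six points
    have hval : ∀ x ∈ C, (γ • e - c) x = γ - c x := by
      intro x hx; simp [h.he x hx]
    have hfac : IsFacet C (γ • e - c) := by
      refine ⟨?_, ?_, ?_⟩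
      · intro h0
        have := hval p hp
        rw [h0] at this
        simp at this
        linarith
      · intro x hx
        rw [hval x hx]
        by_cases hx0 : c x = 0
        · linarith
        by_cases hxp : x = p
        · rw [hxp]; linarith
        · rw [hO x hx hx0 hxp]; linarith
      · intro g hg
        refine ⟨g p / (γ - c p), ?_⟩
        rw [← sub_eq_zero]
        apply h.facet_spans hc
        intro x hx
        rw [Finset.mem_filter] at hx
        rw [LinearMap.sub_apply, LinearMap.smul_apply, hval x hx.1]
        have hd : γ - c p ≠ 0 := by linarith
        by_cases hxp : x = p
        · rw [hxp, smul_eq_mul]; field_simp; ring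
        · have hxγ := hO x hx.1 hx.2 hxp
          rw [hg x hx.1 (by rw [hval x hx.1, hxγ]; ring), hxγ]
          simp
    have hc4 := (h.cards hfac).1
    have : O ⊆ C.filter (fun x => (γ • e - c) x = 0) := by
      intro x hx
      rw [Finset.mem_filter]
      refine ⟨(hOm x hx).1, ?_⟩
      rw [hval x (hOm x hx).1, (hOm x hx).2]; ring
    have := Finset.card_le_card this
    omega
  · have hkey : ∀ s : S, _ := fun s =>
      h.key hc hp hγ hgt hO (Finset.mem_filter.mp s.2).1 (Finset.mem_filter.mp s.2).2
    choose k x q hk hk0 hks hkp hx hq hk1 using hkey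
    have hSC : ∀ s : S, (s : U) ∈ C := fun s => (Finset.mem_filter.mp s.2).1
    have hSc : ∀ s : S, c s = 0 := fun s => (Finset.mem_filter.mp s.2).2
    have hk0' : ∀ s t : S, t ≠ s → k s t = 0 := by
      intro s t hts
      exact hk0 s t (hSC t) (hSc t) (fun h => hts (Subtype.ext h))
    have hScard : Fintype.card S = 4 := by simp [h4]
    have hge : ∀ t : S, 1 ≤ k t (q t) := by
      intro t
      by_contra! hlt
      obtain ⟨s, hst⟩ := Fintype.exists_ne_of_one_lt_card (by omega : 1 < Fintype.card S) t
      obtain ⟨r, hr⟩ := Finset.card_pos.mp (by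
        have := Finset.card_le_two (a := s) (b := t)
        have h2 := Finset.le_card_sdiff {s, t} (Finset.univ : Finset S)
        rw [Finset.card_univ, hScard] at h2
        omega : 0 < ((Finset.univ : Finset S) \ {s, t}).card)
      simp at hr
      have hbval : ∀ z ∈ C, (e - k t) z = 1 - k t z := by
        intro z hz; simp [h.he z hz]
      have hle : ∀ z ∈ C, z ∈ S ∨ z = p ∨ c z = γ := by
        intro z hz
        by_cases hz0 : c z = 0
        · exact Or.inl (by simp [hS, hz, hz0])
        by_cases hzp : z = p
        · exact Or.inr (Or.inl hzp)
        · exact Or.inr (Or.inr (hO z hz hz0 hzp))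
      have hle1 : ∀ z ∈ C, k t z ≤ 1 := by
        intro z hz
        rcases hle z hz with hzS | rfl | hzγ
        · by_cases hzt : (⟨z, hzS⟩ : S) = t
          · have := hks t
            rw [← hzt] at this ⊢
            exact this.le
          · have := hk0' t ⟨z, hzS⟩ hzt
            simp only at this
            linarith
        · exact (hkp t).le
        · by_cases h1 : z = x t
          · rw [h1, (hx t).2.2]; norm_num
          by_cases h2 : z = q t
          · rw [h2]; exact hlt.le
          · exact (hk1 t z hz hzγ h1 h2).le
      have hsub : C.filter (fun z => k s z ≠ 0 ∧ (e - k t) z ≠ 0) ⊆ {(s : U), x t, q t} := by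
        intro z hz
        rw [Finset.mem_filter] at hz
        obtain ⟨hz, hz1, hz2⟩ := hz
        rw [hbval z hz] at hz2
        simp only [Finset.mem_insert, Finset.mem_singleton]
        by_contra! hcon
        rcases hle z hz with hzS | rfl | hzγ
        · exact hz1 (hk0' s ⟨z, hzS⟩ (fun h => hcon.1 (by rw [← h])))
        · exact hz2 (by rw [hkp t]; ring)
        · exact hz2 (by rw [hk1 t z hz hzγ hcon.2.1 hcon.2.2]; ring)
      obtain ⟨hE3, hEc⟩ := finish h.hU e C h.he h.hT (k s) (e - k t) (h.facet_ne (hk s)) (by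
        intro hmem
        obtain ⟨α, β, hab⟩ := Submodule.mem_span_pair.mp hmem
        have e1 := LinearMap.congr_fun hab t
        have e2 := LinearMap.congr_fun hab r
        simp [h.he _ (hSC t), hks t, hk0' s t hst.symm] at e1
        simp [h.he _ (hSC r), hk0' t r hr.2, hk0' s r hr.1] at e2
        linarith) (hk s).nonneg
        (fun z hz _ => by rw [hbval z hz]; linarith [hle1 z hz])
        (C.filter (fun z => k s z ≠ 0 ∧ (e - k t) z ≠ 0)) (by intro z; simp)
        ((Finset.card_le_card hsub).trans Finset.card_le_three)
      have hEeq := Finset.eq_of_subset_of_card_le hsub (by rw [hE3]; exact Finset.card_le_three)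
      have := (hEc (x t) (by rw [hEeq]; simp) (q t) (by rw [hEeq]; simp)).2
      rw [hbval _ (hx t).1, hbval _ (hq t).1, (hx t).2.2] at this
      linarith [(hq t).2.2]
    -- a point outside the zeros
    have himg : (Finset.univ.image x).card ≤ 4 := by
      refine Finset.card_image_le.trans ?_
      rw [Finset.card_univ, hScard]
    obtain ⟨o, ho, hox⟩ := Finset.exists_mem_notMem_of_card_lt_card
      (by omega : (Finset.univ.image x).card < O.card)
    obtain ⟨hoC, hoγ⟩ := hOm o ho
    have hone : ∀ s, 1 ≤ k s o := by
      intro s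
      have h1 : o ≠ x s := by
        rintro rfl
        exact hox (by simp)
      by_cases h2 : o = q s
      · rw [h2]; exact hge s
      · exact (hk1 s o hoC hoγ h1 h2).ge
    set g : Dual ℝ U := (∑ s, k s) - e - (3 / c p) • c with hg
    have hcp : 0 < c p := by linarith
    have hgp : g p = 0 := by
      simp [hg, LinearMap.sum_apply, hkp, h.he p hp, h4]
      field_simp
      norm_num
    obtain ⟨r, hr⟩ := hc.mult g (by
      intro z hz hz0
      have hzS : z ∈ S := by simp [hS, hz, hz0]
      have : ∑ s, k s z = 1 := by
        rw [Finset.sum_eq_single (⟨z, hzS⟩ : S)]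
        · exact hks ⟨z, hzS⟩
        · intro s _ hs
          exact hk0' s ⟨z, hzS⟩ hs.symm
        · simp
      rw [Finset.univ_eq_attach] at this
      simp [hg, LinearMap.sum_apply, this, h.he z hz, hz0])
    have hr0 : r = 0 := by
      rw [hr] at hgp
      simpa [hcp.ne'] using hgp
    have hgo : g o = 0 := by rw [hr, hr0]; simp
    have hsum : (4 : ℝ) ≤ ∑ s, k s o := by
      have := Finset.card_nsmul_le_sum Finset.univ (fun s => k s o) 1 (fun s _ => hone s)
      rw [Finset.card_univ, hScard] at this
      simpa using this
    simp [hg, LinearMap.sum_apply, h.he o hoC, hoγ] at hgo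
    have : 3 / c p * γ < 3 := by
      rw [div_mul_eq_mul_div, div_lt_iff₀ hcp]; linarith
    simp at hsum
    linarith

end TShape

lemma mem_Tset3 (x : Fin 3 → ℝ) (h : x 2 = 0 ∨ (0 ≤ x 2 ∧ (x 1 = 0 ∨ (0 ≤ x 1 ∧ x 0 = 0)))) :
    x ∈ Tset 3 := by
  simp only [Tset, Set.mem_ofPred_eq, Set.mem_empty_iff_false, false_and, or_false]
  rcases h with h | ⟨h1, h | ⟨h2, h3⟩⟩
  · exact Or.inl h
  · exact Or.inr ⟨Or.inl h, h1⟩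
  · exact Or.inr ⟨Or.inr ⟨h3, h2⟩, h1⟩

/-- Every subset of `ℝ⁴` with at most 11 elements is T-shaped. -/
theorem tShaped_of_card_le_eleven (C : Set (Fin 4 → ℝ)) (hC : C.encard ≤ 11) :
    IsTShaped 3 C := by
  classical
  have hfin : C.Finite := Set.finite_of_encard_le_coe (k := 11) hC
  have hcard : hfin.toFinset.card ≤ 11 := by
    rw [hfin.encard_eq_coe_toFinset_card] at hC
    exact_mod_cast hC
  have hU : finrank ℝ ((Fin 4 → ℝ) × ℝ) = 5 := by simp
  let e : Dual ℝ ((Fin 4 → ℝ) × ℝ) := LinearMap.snd ℝ (Fin 4 → ℝ) ℝ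
  let C' : Finset ((Fin 4 → ℝ) × ℝ) := hfin.toFinset.image (fun x => (x, (1 : ℝ)))
  have hTS : TS e C' := by
    by_contra hT
    refine Bad.false (e := e) (C := C') ⟨hU, ?_, hT, Finset.card_image_le.trans hcard⟩
    intro x hx
    obtain ⟨y, -, rfl⟩ := Finset.mem_image.mp hx
    rfl
  obtain ⟨a, b, c, hc, hb, ha, hx⟩ := hTS
  have hd : ∃ d, d ∉ Submodule.span ℝ {e, c, b, a} := by
    by_contra! h
    have h1 : Submodule.span ℝ {e, c, b, a} = ⊤ := by
      rw [eq_top_iff]; intro x _; exact h x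
    have h2 := finrank_span_finset_le_card (R := ℝ) ({e, c, b, a} : Finset (Dual ℝ ((Fin 4 → ℝ) × ℝ)))
    have h3 := Finset.card_le_four (a := e) (b := c) (c := b) (d := a)
    have hs : (({e, c, b, a} : Finset (Dual ℝ ((Fin 4 → ℝ) × ℝ))) : Set (Dual ℝ ((Fin 4 → ℝ) × ℝ))) =
        {e, c, b, a} := by simp
    rw [hs, Set.finrank, h1, finrank_top, Subspace.dual_finrank_eq, hU] at h2
    omega
  obtain ⟨d, hd⟩ := hd
  have he0 : e ≠ 0 := by
    intro h
    have := LinearMap.congr_fun h ((0, 1) : ((Fin 4 → ℝ) × ℝ))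
    simp [e] at this
  have hli : LinearIndependent ℝ ![d, a, b, c, e] := by
    have h1 : LinearIndependent ℝ ![e] := by
      rw [linearIndependent_unique_iff]; simpa using he0
    have h2 : LinearIndependent ℝ ![c, e] := by
      refine linearIndependent_finCons.mpr ⟨h1, ?_⟩
      simpa using hc
    have h3 : LinearIndependent ℝ ![b, c, e] := by
      refine linearIndependent_finCons.mpr ⟨h2, ?_⟩
      simpa [Set.pair_comm] using hb
    have h4 : LinearIndependent ℝ ![a, b, c, e] := by
      refine linearIndependent_finCons.mpr ⟨h3, ?_⟩
      have : Set.range ![b, c, e] = {e, c, b} := by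
        ext z; simp [Matrix.range_cons] <;> tauto
      rw [this]; exact ha
    refine linearIndependent_finCons.mpr ⟨h4, ?_⟩
    have : Set.range ![a, b, c, e] = {e, c, b, a} := by
      ext z; simp [Matrix.range_cons] <;> tauto
    rw [this]; exact hd
  let G : Fin 4 → Dual ℝ ((Fin 4 → ℝ) × ℝ) := ![d, a, b, c]
  let Φ : (Fin 4 → ℝ) →ₗ[ℝ] (Fin 4 → ℝ) :=
    LinearMap.pi (fun i => (G i).comp (LinearMap.inl ℝ (Fin 4 → ℝ) ℝ))
  have hinj : Function.Injective Φ := by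
    rw [← LinearMap.ker_eq_bot, LinearMap.ker_eq_bot']
    intro w hw
    have hspan : Submodule.span ℝ (Set.range ![d, a, b, c, e]) = ⊤ := by
      apply hli.span_eq_top_of_card_eq_finrank
      rw [Subspace.dual_finrank_eq, hU]; simp
    have hz : ((w, 0) : ((Fin 4 → ℝ) × ℝ)) = 0 := by
      rw [← Module.forall_dual_apply_eq_zero_iff ℝ]
      intro φ
      have hφ : φ ∈ Submodule.span ℝ (Set.range ![d, a, b, c, e]) := by rw [hspan]; trivial
      have hle : Submodule.span ℝ (Set.range ![d, a, b, c, e]) ≤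
          LinearMap.ker (Dual.eval ℝ ((Fin 4 → ℝ) × ℝ) ((w, 0) : ((Fin 4 → ℝ) × ℝ))) := by
        rw [Submodule.span_le]
        rintro _ ⟨i, rfl⟩
        have hwi := fun i => congr_fun hw i
        have h0 := hwi 0
        have h1 := hwi 1
        have h2 := hwi 2
        have h3 := hwi 3
        simp [Φ, G] at h0 h1 h2 h3
        fin_cases i <;> simp [h0, h1, h2, h3, e]
      simpa using hle hφ
    exact (Prod.ext_iff.mp hz).1
  let L : (Fin 4 → ℝ) ≃ₗ[ℝ] (Fin 4 → ℝ) := LinearEquiv.ofInjectiveEndo Φ hinj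
  let v : Fin 4 → ℝ := fun i => G i ((0, 1) : ((Fin 4 → ℝ) × ℝ))
  refine ⟨L.toAffineEquiv.trans (AffineEquiv.constVAdd ℝ (Fin 4 → ℝ) v), fun y hy => ?_⟩
  have hval : ∀ i, (L.toAffineEquiv.trans (AffineEquiv.constVAdd ℝ (Fin 4 → ℝ) v)) y i =
      G i ((y, 1) : ((Fin 4 → ℝ) × ℝ)) := by
    intro i
    have h1 : (L.toAffineEquiv.trans (AffineEquiv.constVAdd ℝ (Fin 4 → ℝ) v)) y i =
      G i ((0, 1) : ((Fin 4 → ℝ) × ℝ)) + G i ((y, 0) : ((Fin 4 → ℝ) × ℝ)) := by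
      simp [L, v, Φ]
    rw [h1, ← map_add]
    simp
  have := hx (y, 1) (Finset.mem_image.mpr ⟨y, by simpa using hy, rfl⟩)
  apply mem_Tset3
  simp only [hval]
  exact this
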